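/- arXiv:1012.0996 — 2 statements merged into one kernel-verified Lean document; each statement's English description precedes it below -/
import Mathlib

section
/- Let (Θ,d) be a complete separable metric space with d(s,t) ≤ 1 for all s,t ∈ Θ, let M be a shift-stationary Borel probability measure on Θ^ℕ₀ with invariant probability measure Π on Θ, and let e_m be the empirical distribution map. Then for all positive integers k ≤ m, R_m(M,Π) ≤ R_k(M,Π) + k/m, where R_m(M,Π) = ∫_{Θ^ℕ₀} w(e_m(θ(0),…,θ(m−1)), Π) M(dθ_∞). -/
open MeasureTheory ProbabilityTheory Filter Topology Matrix ENNReal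

/-- The class `BL₁(Θ)` of Borel measurable functions `f : Θ → ℝ` with
`|f s - f t| ≤ d(s,t)` for all `s, t`. -/
def BLone (Θ : Type*) [MeasurableSpace Θ] [PseudoMetricSpace Θ] : Set (Θ → ℝ) :=
  {f | Measurable f ∧ ∀ s t : Θ, |f s - f t| ≤ dist s t}

/-- The bounded Lipschitz distance `w(μ,ν) = sup_{f ∈ BL₁} |∫ f dμ - ∫ f dν|`. -/
noncomputable def blDist {Θ : Type*} [MeasurableSpace Θ] [PseudoMetricSpace Θ]
    (μ ν : Measure Θ) : ℝ :=
  ⨆ f ∈ BLone Θ, |∫ x, f x ∂μ - ∫ x, f x ∂ν|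

/-- The empirical distribution `e_m(θ(0),…,θ(m-1)) = (1/m) ∑_{i<m} δ_{θ(i)}`. -/
noncomputable def emp {Θ : Type*} [MeasurableSpace Θ] (θ : ℕ → Θ) (m : ℕ) : Measure Θ :=
  (m : ℝ≥0∞)⁻¹ • ∑ i ∈ Finset.range m, Measure.dirac (θ i)

/-- The risk `R_m(M,Π) = ∫ w(e_m(θ(0),…,θ(m-1)), Π) M(dθ_∞)`. -/
noncomputable def risk {Θ : Type*} [MeasurableSpace Θ] [PseudoMetricSpace Θ]
    (M : Measure (ℕ → Θ)) (target : Measure Θ) (m : ℕ) : ℝ :=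
  ∫ θ, blDist (emp θ m) target ∂M

/-- The shift `T(θ(0),θ(1),…) = (θ(1),θ(2),…)` on `Θ^{ℕ₀}`. -/
def shift {Θ : Type*} (θ : ℕ → Θ) : ℕ → Θ := fun i => θ (i + 1)

theorem integral_emp {Θ : Type*} [MeasurableSpace Θ] {f : Θ → ℝ} (hf : Measurable f)
    (θ : ℕ → Θ) (n : ℕ) :
    ∫ x, f x ∂(emp θ n) = (n : ℝ)⁻¹ * ∑ i ∈ Finset.range n, f (θ i) := by
  have hint : ∀ i ∈ Finset.range n, Integrable f (Measure.dirac (θ i)) := fun i _ =>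
    integrable_dirac' hf.stronglyMeasurable (by simp)
  rw [emp, integral_smul_measure, integral_finsetSum_measure hint]
  simp [integral_dirac' f _ hf.stronglyMeasurable]

theorem mul_abs_integral_emp_sub {Θ : Type*} [MeasurableSpace Θ] {f : Θ → ℝ} (hf : Measurable f)
    (θ : ℕ → Θ) (n : ℕ) (a : ℝ) :
    n * |∫ x, f x ∂(emp θ n) - a| = |∑ i ∈ Finset.range n, (f (θ i) - a)| := by
  rw [integral_emp hf]
  rcases Nat.eq_zero_or_pos n with rfl | hn
  · simp
  · have hn' : (0 : ℝ) < n := by exact_mod_cast hn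
    nth_rewrite 1 [← abs_of_pos hn']
    rw [← abs_mul]
    congr 1
    rw [Finset.sum_sub_distrib, Finset.sum_const, Finset.card_range, nsmul_eq_mul]
    field_simp

section BlDist

variable {Θ : Type*} [PseudoMetricSpace Θ] [MeasurableSpace Θ]

theorem blDist_nonneg (μ ν : Measure Θ) : 0 ≤ blDist μ ν :=
  Real.iSup_nonneg fun _ => Real.iSup_nonneg fun _ => abs_nonneg _

theorem integrable_of_mem_BLone (hd : ∀ s t : Θ, dist s t ≤ 1) (μ : Measure Θ)
    [IsProbabilityMeasure μ] {f : Θ → ℝ} (hf : f ∈ BLone Θ) : Integrable f μ := by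
  obtain ⟨x₀⟩ := nonempty_of_isProbabilityMeasure μ
  refine Integrable.of_bound hf.1.aestronglyMeasurable (|f x₀| + 1) (ae_of_all _ fun x => ?_)
  have h := (hf.2 x x₀).trans (hd x x₀)
  have h' := abs_sub_abs_le_abs_sub (f x) (f x₀)
  rw [Real.norm_eq_abs]
  linarith

theorem abs_sub_integral_le_one (hd : ∀ s t : Θ, dist s t ≤ 1) (μ : Measure Θ)
    [IsProbabilityMeasure μ] {f : Θ → ℝ} (hf : f ∈ BLone Θ) (x : Θ) :
    |f x - ∫ y, f y ∂μ| ≤ 1 := by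
  have hint := integrable_of_mem_BLone hd μ hf
  have h : f x - ∫ y, f y ∂μ = ∫ y, (f x - f y) ∂μ := by
    rw [integral_sub (integrable_const _) hint]
    simp
  rw [h, ← Real.norm_eq_abs]
  refine (norm_integral_le_of_norm_le_const (C := 1) (ae_of_all _ fun y => ?_)).trans (by simp)
  exact (hf.2 x y).trans (hd x y)

/-- An upper bound for all centred sums bounds the unnormalized distance. -/
theorem mul_blDist_emp_le (ν : Measure Θ) (θ : ℕ → Θ) (n : ℕ) {C : ℝ} (hC : 0 ≤ C)
    (h : ∀ f ∈ BLone Θ, |∑ i ∈ Finset.range n, (f (θ i) - ∫ y, f y ∂ν)| ≤ C) :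
    n * blDist (emp θ n) ν ≤ C := by
  rcases Nat.eq_zero_or_pos n with rfl | hn
  · simpa using hC
  · have hn' : (0 : ℝ) < n := by exact_mod_cast hn
    rw [← le_div_iff₀' hn']
    have hC' : 0 ≤ C / n := by positivity
    refine Real.iSup_le (fun f => Real.iSup_le (fun hf => ?_) hC') hC'
    rw [le_div_iff₀' hn', mul_abs_integral_emp_sub hf.1]
    exact h f hf

theorem abs_sum_sub_integral_le (hd : ∀ s t : Θ, dist s t ≤ 1) (ν : Measure Θ)
    [IsProbabilityMeasure ν] {f : Θ → ℝ} (hf : f ∈ BLone Θ) (θ : ℕ → Θ) (n : ℕ) :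
    |∑ i ∈ Finset.range n, (f (θ i) - ∫ y, f y ∂ν)| ≤ n := by
  refine (Finset.abs_sum_le_sum_abs _ _).trans ?_
  refine (Finset.sum_le_sum fun i _ => abs_sub_integral_le_one hd ν hf (θ i)).trans ?_
  simp

theorem mul_blDist_emp_le_self (hd : ∀ s t : Θ, dist s t ≤ 1) (ν : Measure Θ)
    [IsProbabilityMeasure ν] (θ : ℕ → Θ) (n : ℕ) : n * blDist (emp θ n) ν ≤ n :=
  mul_blDist_emp_le ν θ n n.cast_nonneg fun _ hf => abs_sum_sub_integral_le hd ν hf θ n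

theorem abs_sum_sub_integral_le_mul_blDist (hd : ∀ s t : Θ, dist s t ≤ 1) (ν : Measure Θ)
    [IsProbabilityMeasure ν] {f : Θ → ℝ} (hf : f ∈ BLone Θ) (θ : ℕ → Θ) (n : ℕ) :
    |∑ i ∈ Finset.range n, (f (θ i) - ∫ y, f y ∂ν)| ≤ n * blDist (emp θ n) ν := by
  rcases Nat.eq_zero_or_pos n with rfl | hn
  · simp
  have hn' : (0 : ℝ) < n := by exact_mod_cast hn
  rw [← mul_abs_integral_emp_sub hf.1]
  refine mul_le_mul_of_nonneg_left ?_ hn'.le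
  have hbdd : BddAbove (Set.range fun g : Θ → ℝ =>
      ⨆ _ : g ∈ BLone Θ, |∫ x, g x ∂(emp θ n) - ∫ x, g x ∂ν|) := by
    refine ⟨1, ?_⟩
    rintro _ ⟨g, rfl⟩
    refine Real.iSup_le (fun hg => ?_) zero_le_one
    have h := abs_sum_sub_integral_le hd ν hg θ n
    rw [← mul_abs_integral_emp_sub hg.1] at h
    nlinarith
  have h := le_ciSup hbdd f
  rwa [ciSup_pos hf] at h

theorem mul_blDist_emp_add_le (hd : ∀ s t : Θ, dist s t ≤ 1) (ν : Measure Θ)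
    [IsProbabilityMeasure ν] (θ : ℕ → Θ) (m n : ℕ) :
    ((m + n : ℕ) : ℝ) * blDist (emp θ (m + n)) ν ≤
      m * blDist (emp θ m) ν + n * blDist (emp (fun i => θ (m + i)) n) ν := by
  have h₁ := blDist_nonneg (emp θ m) ν
  have h₂ := blDist_nonneg (emp (fun i => θ (m + i)) n) ν
  refine mul_blDist_emp_le ν θ (m + n) (by positivity) fun f hf => ?_
  rw [Finset.sum_range_add]
  exact (abs_add_le _ _).trans (add_le_add (abs_sum_sub_integral_le_mul_blDist hd ν hf θ m)
    (abs_sum_sub_integral_le_mul_blDist hd ν hf (fun i => θ (m + i)) n))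

theorem mul_blDist_emp_le_add_sum_dist (hd : ∀ s t : Θ, dist s t ≤ 1) (ν : Measure Θ)
    [IsProbabilityMeasure ν] (θ η : ℕ → Θ) (n : ℕ) :
    n * blDist (emp θ n) ν ≤ n * blDist (emp η n) ν + ∑ i ∈ Finset.range n, dist (θ i) (η i) := by
  have h₁ := blDist_nonneg (emp η n) ν
  have h₂ : 0 ≤ ∑ i ∈ Finset.range n, dist (θ i) (η i) := Finset.sum_nonneg fun _ _ => dist_nonneg
  refine mul_blDist_emp_le ν θ n (by positivity) fun f hf => ?_
  have h : ∑ i ∈ Finset.range n, (f (θ i) - ∫ y, f y ∂ν) =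
      ∑ i ∈ Finset.range n, (f (η i) - ∫ y, f y ∂ν) +
        ∑ i ∈ Finset.range n, (f (θ i) - f (η i)) := by
    rw [← Finset.sum_add_distrib]
    exact Finset.sum_congr rfl fun _ _ => by ring
  rw [h]
  refine (abs_add_le _ _).trans (add_le_add (abs_sum_sub_integral_le_mul_blDist hd ν hf η n) ?_)
  exact (Finset.abs_sum_le_sum_abs _ _).trans (Finset.sum_le_sum fun i _ => hf.2 _ _)

theorem continuous_mul_blDist_emp (hd : ∀ s t : Θ, dist s t ≤ 1) (ν : Measure Θ)
    [IsProbabilityMeasure ν] (n : ℕ) :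
    Continuous fun θ : ℕ → Θ => (n : ℝ) * blDist (emp θ n) ν := by
  refine continuous_iff_continuousAt.2 fun η => ?_
  have hlim : Tendsto (fun θ : ℕ → Θ => ∑ i ∈ Finset.range n, dist (θ i) (η i)) (𝓝 η) (𝓝 0) := by
    have hc : Continuous fun θ : ℕ → Θ => ∑ i ∈ Finset.range n, dist (θ i) (η i) := by fun_prop
    simpa using hc.tendsto η
  refine tendsto_iff_dist_tendsto_zero.2
    (squeeze_zero (fun _ => dist_nonneg) (fun θ => ?_) hlim)
  have h₁ := mul_blDist_emp_le_add_sum_dist hd ν θ η n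
  have h₂ := mul_blDist_emp_le_add_sum_dist hd ν η θ n
  simp only [dist_comm (η _) (θ _)] at h₂
  rw [Real.dist_eq, abs_sub_le_iff]
  constructor <;> linarith

theorem integrable_mul_blDist_emp [SecondCountableTopology Θ] [BorelSpace Θ]
    (hd : ∀ s t : Θ, dist s t ≤ 1) (ν : Measure Θ)
    [IsProbabilityMeasure ν] (M : Measure (ℕ → Θ)) [IsProbabilityMeasure M] (n : ℕ) :
    Integrable (fun θ : ℕ → Θ => (n : ℝ) * blDist (emp θ n) ν) M := by
  refine Integrable.of_bound (continuous_mul_blDist_emp hd ν n).aestronglyMeasurable n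
    (ae_of_all _ fun θ => ?_)
  have h := blDist_nonneg (emp θ n) ν
  rw [Real.norm_eq_abs, abs_of_nonneg (by positivity)]
  exact mul_blDist_emp_le_self hd ν θ n

end BlDist

theorem measurePreserving_shift {Θ : Type*} [MeasurableSpace Θ] {M : Measure (ℕ → Θ)}
    (hstat : M.map shift = M) : MeasurePreserving shift M M :=
  ⟨measurable_pi_lambda _ fun i => measurable_pi_apply (i + 1), hstat⟩

theorem shift_iterate {Θ : Type*} (m : ℕ) (θ : ℕ → Θ) :
    shift^[m] θ = fun i => θ (m + i) := by
  induction m generalizing θ with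
  | zero => simp
  | succ m ih =>
    rw [Function.iterate_succ_apply, ih]
    funext i
    simp only [shift]
    congr 1
    omega

/-- The unnormalized risk of a stationary process is a subadditive sequence. -/
theorem subadditive_mul_risk {Θ : Type*} [PseudoMetricSpace Θ] [SecondCountableTopology Θ]
    [MeasurableSpace Θ] [BorelSpace Θ] (hd : ∀ s t : Θ, dist s t ≤ 1)
    (M : Measure (ℕ → Θ)) [IsProbabilityMeasure M] (hstat : M.map shift = M)
    (ν : Measure Θ) [IsProbabilityMeasure ν] : Subadditive fun n : ℕ => (n : ℝ) * risk M ν n := by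
  intro m n
  have hT : MeasurePreserving (fun (θ : ℕ → Θ) i => θ (m + i)) M M := by
    have h := (measurePreserving_shift hstat).iterate m
    rwa [show (shift^[m] : (ℕ → Θ) → ℕ → Θ) = fun θ i => θ (m + i) from
      funext fun θ => shift_iterate m θ] at h
  have hint := integrable_mul_blDist_emp hd ν M
  have hn : ∫ θ, (n : ℝ) * blDist (emp (fun i => θ (m + i)) n) ν ∂M =
      ∫ θ, (n : ℝ) * blDist (emp θ n) ν ∂M := by
    have h := integral_map (μ := M) hT.measurable.aemeasurable
      (f := fun θ : ℕ → Θ => (n : ℝ) * blDist (emp θ n) ν)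
      (continuous_mul_blDist_emp hd ν n).aestronglyMeasurable
    rw [hT.map_eq] at h
    exact h.symm
  have hint' : Integrable (fun θ : ℕ → Θ => (n : ℝ) * blDist (emp (fun i => θ (m + i)) n) ν) M :=
    hT.integrable_comp_of_integrable (hint n)
  simp only [risk, ← integral_const_mul]
  rw [← hn, ← integral_add (hint m) hint']
  exact integral_mono (hint (m + n)) ((hint m).add hint') fun θ =>
    mul_blDist_emp_add_le hd ν θ m n

/-- For a shift-stationary probability measure `M` on `Θ^{ℕ₀}` with invariant
marginal `Π`, over a complete separable metric space with `d ≤ 1`, one has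
`R_m(M,Π) ≤ R_k(M,Π) + k/m` for all positive integers `k ≤ m`. -/
theorem stationary_risk_subadditive {Θ : Type*} [MetricSpace Θ] [CompleteSpace Θ]
    [TopologicalSpace.SeparableSpace Θ] [MeasurableSpace Θ] [BorelSpace Θ]
    (hd : ∀ s t : Θ, dist s t ≤ 1)
    (M : Measure (ℕ → Θ)) [IsProbabilityMeasure M]
    (hstat : M.map shift = M)
    (target : Measure Θ) (htarget : target = M.map fun θ => θ 0)
    (k m : ℕ) (hk : 1 ≤ k) (hkm : k ≤ m) :
    risk M target m ≤ risk M target k + (k : ℝ) / m := by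
  have : SecondCountableTopology Θ := UniformSpace.secondCountable_of_separable Θ
  have : IsProbabilityMeasure target := by
    rw [htarget]
    exact Measure.isProbabilityMeasure_map (measurable_pi_apply 0).aemeasurable
  have hsub := (subadditive_mul_risk hd M hstat target).apply_mul_add_le (m / k) k (m % k)
  have hle : ((m % k : ℕ) : ℝ) * risk M target (m % k) ≤ k := by
    rw [risk, ← integral_const_mul]
    calc ∫ θ, ((m % k : ℕ) : ℝ) * blDist (emp θ (m % k)) target ∂M
        ≤ ∫ _, ((m % k : ℕ) : ℝ) ∂M :=
          integral_mono (integrable_mul_blDist_emp hd target M _) (integrable_const _) fun θ =>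
            mul_blDist_emp_le_self hd target θ _
      _ = ((m % k : ℕ) : ℝ) := by simp
      _ ≤ k := by exact_mod_cast (Nat.mod_lt m hk).le
  have hpos : 0 ≤ risk M target k := integral_nonneg fun θ => blDist_nonneg _ _
  have hm : (0 : ℝ) < m := by exact_mod_cast hk.trans hkm
  have hqk : ((m / k : ℕ) : ℝ) * k ≤ m := by exact_mod_cast Nat.div_mul_le_self m k
  simp only [Nat.div_add_mod'] at hsub
  have hmul : ((m / k : ℕ) : ℝ) * (k * risk M target k) ≤ m * risk M target k := by
    rw [← mul_assoc]
    exact mul_le_mul_of_nonneg_right hqk hpos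
  refine le_of_mul_le_mul_left ?_ hm
  rw [mul_add, mul_div_cancel₀ _ hm.ne']
  linarith
end

section
/- (Le Cam) Let (Θ,d) be a separable and complete metric space with Borel σ-algebra Ξ. Let μ_i be a Borel probability measure on Θ and K_i a probability transition kernel from Θ to itself, for i = 1,2. Then ∫_Θ ‖K_1(x,·) − K_2(x,·)‖ (μ_1 + μ_2)(dx) ≤ 4 ‖μ_1 ⊗ K_1 − μ_2 ⊗ K_2‖, where (μ ⊗ K)(dx,dy) = μ(dx)K(x,dy) and ‖·‖ is the total variation distance ‖p − q‖ = sup_A |p(A) − q(A)|. -/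
open MeasureTheory ProbabilityTheory Filter Topology Matrix ENNReal

/-- Total variation distance `‖p - q‖ = sup_A |p(A) - q(A)|`. -/
noncomputable def tvDist {E : Type*} [MeasurableSpace E] (p q : Measure E) : ℝ :=
  ⨆ A : {A : Set E // MeasurableSet A}, |(p A.1).toReal - (q A.1).toReal|

section TotalVariation

variable {E : Type*} [MeasurableSpace E]

lemma tvDist_comm (p q : Measure E) : tvDist p q = tvDist q p := by
  simp only [tvDist, abs_sub_comm]

lemma sub_le_tvDist (p q : Measure E) [IsFiniteMeasure p] [IsFiniteMeasure q]
    {A : Set E} (hA : MeasurableSet A) : p.real A - q.real A ≤ tvDist p q := by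
  have hbdd : BddAbove (Set.range fun A : {A : Set E // MeasurableSet A} ↦
      |(p A.1).toReal - (q A.1).toReal|) := by
    refine ⟨p.real Set.univ + q.real Set.univ, ?_⟩
    rintro _ ⟨A, rfl⟩
    change |p.real A.1 - q.real A.1| ≤ _
    have hp : p.real A.1 ≤ p.real Set.univ := measureReal_mono (Set.subset_univ _)
    have hq : q.real A.1 ≤ q.real Set.univ := measureReal_mono (Set.subset_univ _)
    have hp' : 0 ≤ p.real A.1 := measureReal_nonneg
    have hq' : 0 ≤ q.real A.1 := measureReal_nonneg
    rw [abs_le]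
    constructor <;> linarith
  exact (le_abs_self _).trans (le_ciSup hbdd ⟨A, hA⟩)

/-- `B` is a Hahn set for `p - q`: this difference is nonnegative inside `B` and nonpositive
outside of it. -/
structure IsHahnSet (p q : Measure E) (B : Set E) : Prop where
  measurableSet : MeasurableSet B
  restrict_le : q.restrict B ≤ p.restrict B
  restrict_compl_le : p.restrict Bᶜ ≤ q.restrict Bᶜ

lemma exists_isHahnSet (p q : Measure E) [IsFiniteMeasure p] [IsFiniteMeasure q] :
    ∃ B, IsHahnSet p q B := by
  obtain ⟨B, hB, hle, hge⟩ := hahn_decomposition p q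
  refine ⟨B, hB, Measure.le_iff.2 fun t ht ↦ ?_, Measure.le_iff.2 fun t ht ↦ ?_⟩
  · rw [Measure.restrict_apply ht, Measure.restrict_apply ht]
    exact hle _ (ht.inter hB) Set.inter_subset_right
  · rw [Measure.restrict_apply ht, Measure.restrict_apply ht]
    exact hge _ (ht.inter hB.compl) Set.inter_subset_right

lemma IsHahnSet.integral_sub_integral_le {p q : Measure E} [IsFiniteMeasure p]
    [IsFiniteMeasure q] {B : Set E} (hB : IsHahnSet p q B) {f : E → ℝ} (hf : Measurable f)
    (hf0 : ∀ x, 0 ≤ f x) (hf1 : ∀ x, f x ≤ 1) :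
    ∫ x, f x ∂p - ∫ x, f x ∂q ≤ p.real B - q.real B := by
  have hint (m : Measure E) [IsFiniteMeasure m] : Integrable f m :=
    Integrable.of_bound hf.aestronglyMeasurable 1
      (ae_of_all _ fun x ↦ by rw [Real.norm_of_nonneg (hf0 x)]; exact hf1 x)
  have hcompl : ∫ x in Bᶜ, f x ∂p ≤ ∫ x in Bᶜ, f x ∂q :=
    integral_mono_measure hB.restrict_compl_le (ae_of_all _ hf0) (hint _)
  have hon : ∫ x in B, (1 - f x) ∂q ≤ ∫ x in B, (1 - f x) ∂p :=
    integral_mono_measure hB.restrict_le (ae_of_all _ fun x ↦ sub_nonneg.2 (hf1 x))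
      ((integrable_const _).sub (hint _))
  rw [integral_sub (integrable_const _) (hint _), integral_sub (integrable_const _) (hint _)] at hon
  simp only [integral_const, smul_eq_mul, mul_one, measureReal_restrict_apply_univ] at hon
  rw [← integral_add_compl hB.measurableSet (hint p), ← integral_add_compl hB.measurableSet (hint q)]
  linarith

lemma integral_sub_integral_le_tvDist (p q : Measure E) [IsFiniteMeasure p] [IsFiniteMeasure q]
    {f : E → ℝ} (hf : Measurable f) (hf0 : ∀ x, 0 ≤ f x) (hf1 : ∀ x, f x ≤ 1) :
    ∫ x, f x ∂p - ∫ x, f x ∂q ≤ tvDist p q := by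
  obtain ⟨B, hB⟩ := exists_isHahnSet p q
  exact (hB.integral_sub_integral_le hf hf0 hf1).trans (sub_le_tvDist p q hB.measurableSet)

lemma IsHahnSet.tvDist_eq {p q : Measure E} [IsProbabilityMeasure p] [IsProbabilityMeasure q]
    {B : Set E} (hB : IsHahnSet p q B) : tvDist p q = p.real B - q.real B := by
  refine le_antisymm ?_ (sub_le_tvDist p q hB.measurableSet)
  have key {A : Set E} (hA : MeasurableSet A) :
      p.real A - q.real A ≤ p.real B - q.real B := by
    have h := hB.integral_sub_integral_le (f := A.indicator 1)
      (measurable_one.indicator hA) (Set.indicator_nonneg fun _ _ ↦ zero_le_one)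
      (Set.indicator_le_self' (fun _ _ ↦ zero_le_one) ·)
    simpa only [integral_indicator_one hA] using h
  have : Nonempty {A : Set E // MeasurableSet A} := ⟨⟨∅, .empty⟩⟩
  refine ciSup_le fun ⟨A, hA⟩ ↦ abs_le'.2 ⟨key hA, ?_⟩
  have h := key hA.compl
  rw [probReal_compl_eq_one_sub hA, probReal_compl_eq_one_sub hA] at h
  change -(p.real A - q.real A) ≤ _
  linarith

lemma tvDist_le_tvDist_compProd {F : Type*} [MeasurableSpace F] (p q : Measure E)
    [IsFiniteMeasure p] [IsFiniteMeasure q] (κ η : Kernel E F) [IsMarkovKernel κ]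
    [IsMarkovKernel η] : tvDist p q ≤ tvDist (p ⊗ₘ κ) (q ⊗ₘ η) := by
  have : Nonempty {A : Set E // MeasurableSet A} := ⟨⟨∅, .empty⟩⟩
  refine ciSup_le fun ⟨A, hA⟩ ↦ ?_
  have hp : p A = (p ⊗ₘ κ) (A ×ˢ Set.univ) := by
    simp [Measure.compProd_apply_prod hA .univ]
  have hq : q A = (q ⊗ₘ η) (A ×ˢ Set.univ) := by
    simp [Measure.compProd_apply_prod hA .univ]
  have hAu : MeasurableSet (A ×ˢ (Set.univ : Set F)) := hA.prod .univ
  simp only [hp, hq]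
  refine abs_le'.2 ⟨sub_le_tvDist _ _ hAu, ?_⟩
  rw [neg_sub, tvDist_comm]
  exact sub_le_tvDist _ _ hAu

/-- Hahn sets for two finite kernels can be chosen measurably in the parameter. -/
lemma exists_measurableSet_isHahnSet {F : Type*} [MeasurableSpace F]
    [MeasurableSpace.CountableOrCountablyGenerated E F] (κ η : Kernel E F) [IsFiniteKernel κ]
    [IsFiniteKernel η] :
    ∃ S : Set (E × F), MeasurableSet S ∧ ∀ x, IsHahnSet (κ x) (η x) (Prod.mk x ⁻¹' S) := by
  have hdens (ξ : Kernel E F) [IsFiniteKernel ξ] (hξ : ∀ x, ξ x ≪ (κ + η) x) (x : E) :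
      ((κ + η) x).withDensity (ξ.rnDeriv (κ + η) x) = ξ x := by
    rw [← Kernel.withDensity_apply _ (Kernel.measurable_rnDeriv _ _)]
    conv_rhs => rw [← Kernel.rnDeriv_add_singularPart ξ (κ + η), _root_.add_apply,
      (Kernel.singularPart_eq_zero_iff_absolutelyContinuous ξ (κ + η) x).2 (hξ x), add_zero]
  have hκ := hdens κ fun x ↦ (Measure.le_add_right le_rfl).absolutelyContinuous
  have hη := hdens η fun x ↦ (Measure.le_add_left le_rfl).absolutelyContinuous
  set S : Set (E × F) :=
    {z | η.rnDeriv (κ + η) z.1 z.2 ≤ κ.rnDeriv (κ + η) z.1 z.2}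
  have hS : MeasurableSet S :=
    measurableSet_le (Kernel.measurable_rnDeriv _ _) (Kernel.measurable_rnDeriv _ _)
  refine ⟨S, hS, fun x ↦ ?_⟩
  have hSx : MeasurableSet (Prod.mk x ⁻¹' S) := measurable_prodMk_left hS
  refine ⟨hSx, ?_, ?_⟩
  · rw [← hκ x, ← hη x, restrict_withDensity hSx, restrict_withDensity hSx]
    exact withDensity_mono (ae_restrict_of_forall_mem hSx fun y hy ↦ hy)
  · rw [← hκ x, ← hη x, restrict_withDensity hSx.compl, restrict_withDensity hSx.compl]
    exact withDensity_mono (ae_restrict_of_forall_mem hSx.compl fun y hy ↦ le_of_not_ge hy)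

end TotalVariation

/-- **Le Cam.** For probability measures `μ₁, μ₂` on a complete separable
metric space `Θ` and Markov kernels `K₁, K₂` on `Θ`,
`∫ ‖K₁(x,·) − K₂(x,·)‖ (μ₁+μ₂)(dx) ≤ 4 ‖μ₁ ⊗ K₁ − μ₂ ⊗ K₂‖`. -/
theorem leCam_kernel_tv_bound {Θ : Type*} [MetricSpace Θ] [CompleteSpace Θ]
    [TopologicalSpace.SeparableSpace Θ] [MeasurableSpace Θ] [BorelSpace Θ]
    (μ₁ μ₂ : Measure Θ) [IsProbabilityMeasure μ₁] [IsProbabilityMeasure μ₂]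
    (K₁ K₂ : Kernel Θ Θ) [IsMarkovKernel K₁] [IsMarkovKernel K₂] :
    ∫ x, tvDist (K₁ x) (K₂ x) ∂(μ₁ + μ₂) ≤ 4 * tvDist (μ₁ ⊗ₘ K₁) (μ₂ ⊗ₘ K₂) := by
  have : SecondCountableTopology Θ := UniformSpace.secondCountable_of_separable Θ
  obtain ⟨S, hS, hHahn⟩ := exists_measurableSet_isHahnSet K₁ K₂
  have hmeas (K : Kernel Θ Θ) [IsMarkovKernel K] :
      Measurable fun x ↦ (K x).real (Prod.mk x ⁻¹' S) :=
    (Kernel.measurable_kernel_prodMk_left hS).ennreal_toReal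
  have hint (K : Kernel Θ Θ) [IsMarkovKernel K] (μ : Measure Θ) [IsFiniteMeasure μ] :
      Integrable (fun x ↦ (K x).real (Prod.mk x ⁻¹' S)) μ :=
    Integrable.of_bound (hmeas K).aestronglyMeasurable 1
      (ae_of_all _ fun x ↦ by
        rw [Real.norm_of_nonneg measureReal_nonneg]; exact measureReal_le_one)
  have hcompProd (K : Kernel Θ Θ) [IsMarkovKernel K] (μ : Measure Θ) [IsProbabilityMeasure μ] :
      ∫ x, (K x).real (Prod.mk x ⁻¹' S) ∂μ = (μ ⊗ₘ K).real S := by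
    rw [measureReal_def, Measure.compProd_apply hS]
    exact integral_toReal (Kernel.measurable_kernel_prodMk_left hS).aemeasurable
      (ae_of_all _ fun x ↦ measure_lt_top _ _)
  have hjoint := sub_le_tvDist (μ₁ ⊗ₘ K₁) (μ₂ ⊗ₘ K₂) hS
  have hmarginal := tvDist_le_tvDist_compProd μ₁ μ₂ K₁ K₂
  have hK₁ := integral_sub_integral_le_tvDist μ₂ μ₁ (hmeas K₁)
    (fun _ ↦ measureReal_nonneg) (fun _ ↦ measureReal_le_one)
  have hK₂ := integral_sub_integral_le_tvDist μ₂ μ₁ (hmeas K₂)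
    (fun _ ↦ measureReal_nonneg) (fun _ ↦ measureReal_le_one)
  rw [tvDist_comm μ₂ μ₁] at hK₁ hK₂
  simp only [hcompProd] at hK₁ hK₂
  simp_rw [fun x ↦ (hHahn x).tvDist_eq]
  rw [integral_sub (hint _ _) (hint _ _), integral_add_measure (hint _ _) (hint _ _),
    integral_add_measure (hint _ _) (hint _ _)]
  simp only [hcompProd]
  linarith
end
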